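/- For every simple left S_n-module M, the endomorphism ring End_{S_n}(M) is commutative and is a finite-dimensional field extension of K. -/

import Mathlib

set_option synthInstance.maxHeartbeats 1000000
set_option maxHeartbeats 1000000

open MvPolynomial

noncomputable section

/-- The polynomial algebra `P_n = K[x_1, …, x_n]`. -/
abbrev PolyAlg (K : Type u) [Field K] (n : ℕ) := MvPolynomial (Fin n) K

/-- `X_i` : multiplication by the variable `x_i`, as a `K`-linear endomorphism of `P_n`. -/
def Xop (K : Type u) [Field K] (n : ℕ) (i : Fin n) : Module.End K (PolyAlg K n) :=
  LinearMap.mulLeft K (X i)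

/-- `Y_i` : the left inverse of `X_i`, sending a monomial `x^α` to `x^{α - e_i}` if `α i ≥ 1`
and to `0` otherwise. -/
def Yop (K : Type u) [Field K] (n : ℕ) (i : Fin n) : Module.End K (PolyAlg K n) :=
  (basisMonomials (Fin n) K).constr K fun α =>
    if α i = 0 then 0 else monomial (α - Finsupp.single i 1) (1 : K)

/-- The algebra `S_n` of one-sided inverses of `P_n` : the subalgebra of `End_K(P_n)`
generated by `X_1, …, X_n, Y_1, …, Y_n`. -/
def SnAlg (K : Type u) [Field K] (n : ℕ) : Subalgebra K (Module.End K (PolyAlg K n)) :=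
  Algebra.adjoin K (Set.range (Xop K n) ∪ Set.range (Yop K n))

/-- `x_i` as an element of `S_n`. -/
def xS (K : Type u) [Field K] (n : ℕ) (i : Fin n) : SnAlg K n :=
  ⟨Xop K n i, Algebra.subset_adjoin (Set.mem_union_left _ ⟨i, rfl⟩)⟩

/-- `y_i` as an element of `S_n`. -/
def yS (K : Type u) [Field K] (n : ℕ) (i : Fin n) : SnAlg K n :=
  ⟨Yop K n i, Algebra.subset_adjoin (Set.mem_union_right _ ⟨i, rfl⟩)⟩

/-- The product `I*J` of two two-sided ideals: the two-sided ideal generated by all products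
`a * b` with `a ∈ I`, `b ∈ J`. -/
def tsiMul {R : Type*} [Ring R] (I J : TwoSidedIdeal R) : TwoSidedIdeal R :=
  TwoSidedIdeal.span {x | ∃ a ∈ I, ∃ b ∈ J, x = a * b}

/-- A two-sided ideal `P` of a ring is prime if it is proper and for all two-sided ideals
`I`, `J`, `I*J ⊆ P` implies `I ⊆ P` or `J ⊆ P`. -/
def tsiPrime {R : Type*} [Ring R] (P : TwoSidedIdeal R) : Prop :=
  P ≠ ⊤ ∧ ∀ I J : TwoSidedIdeal R, tsiMul I J ≤ P → I ≤ P ∨ J ≤ P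

/-- The canonical `K`-algebra structure map `K →+* End_{A}(M)` for an `A`-module `M`, where `A`
is a `K`-algebra: `c` acts on `M` as multiplication by the central element `algebraMap K A c`. -/
def centralEnd (K : Type u) [CommRing K] (A : Type v) [Ring A] [Algebra K A]
    (M : Type w) [AddCommGroup M] [Module A M] : K →+* Module.End A M where
  toFun c :=
    { toFun := fun m => algebraMap K A c • m
      map_add' := fun m m' => smul_add _ m m'
      map_smul' := fun a m => by
        simp only [RingHom.id_apply, smul_smul]
        rw [Algebra.commutes] }
  map_one' := by ext m; simp
  map_mul' c d := by
    ext m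
    show algebraMap K A (c * d) • m = algebraMap K A c • (algebraMap K A d • m)
    rw [map_mul, mul_smul]
  map_zero' := by ext m; simp
  map_add' c d := by ext m; simp [map_add, add_smul]

section OneSidedInverses

universe u v w

variable {K : Type u} [Field K]

/-- A simple module over a commutative algebra of finite type over a field is finite-dimensional,
and its endomorphisms commute. -/
theorem finite_and_comm_of_simple_of_comm (A : Type v) {V : Type w} [CommRing A] [Algebra K A]
    [Algebra.FiniteType K A] [AddCommGroup V] [Module K V] [Module A V] [IsScalarTower K A V]
    [IsSimpleModule A V] :
    Module.Finite K V ∧ ∀ f g : Module.End A V, f * g = g * f := by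
  constructor
  · obtain ⟨I, hI, ⟨e⟩⟩ := isSimpleModule_iff_quot_maximal.mp ‹IsSimpleModule A V›
    let := Ideal.Quotient.field I
    have : Algebra.FiniteType K (A ⧸ I) :=
      Algebra.FiniteType.of_surjective (Ideal.Quotient.mkₐ K I) (Ideal.Quotient.mkₐ_surjective K I)
    have : Module.Finite K (A ⧸ I) := finite_of_finite_type_of_isJacobsonRing K (A ⧸ I)
    exact Module.Finite.equiv (e.restrictScalars K).symm
  · intro f g
    ext m
    by_cases hm : m = 0
    · simp [hm]
    obtain ⟨a, ha⟩ := IsSimpleModule.toSpanSingleton_surjective A hm (f m)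
    obtain ⟨b, hb⟩ := IsSimpleModule.toSpanSingleton_surjective A hm (g m)
    simp only [LinearMap.toSpanSingleton_apply] at ha hb
    simp [Module.End.mul_apply, ← ha, ← hb, smul_smul, mul_comm]

/-- A family of operators, each pair `x i, y i` for `i ∈ t` satisfying the relations of the
algebra of one-sided inverses, acting on `V` without non-trivial common invariant subspaces. -/
structure IsSimpleOneSided {ι : Type w} {V : Type v} [AddCommGroup V] [Module K V] (t : Set ι)
    (x y : ι → Module.End K V) : Prop where
  yx : ∀ i ∈ t, y i * x i = 1
  xx : ∀ i ∈ t, ∀ j ∈ t, i ≠ j → Commute (x i) (x j)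
  xy : ∀ i ∈ t, ∀ j ∈ t, i ≠ j → Commute (x i) (y j)
  yy : ∀ i ∈ t, ∀ j ∈ t, i ≠ j → Commute (y i) (y j)
  nontrivial : Nontrivial V
  simple : ∀ U : Submodule K V, (∀ i ∈ t, ∀ m ∈ U, x i m ∈ U ∧ y i m ∈ U) → U = ⊥ ∨ U = ⊤

/-- The operators commuting with all `x i` and `y i`, for `i ∈ t`. -/
abbrev opCentralizer {ι : Type w} {V : Type v} [AddCommGroup V] [Module K V] (t : Set ι)
    (x y : ι → Module.End K V) : Subalgebra K (Module.End K V) :=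
  Subalgebra.centralizer K (x '' t ∪ y '' t)

namespace IsSimpleOneSided

variable {ι : Type w} {V : Type v} [AddCommGroup V] [Module K V] {t : Set ι}
  {x y : ι → Module.End K V}

theorem commute_of_mem_opCentralizer {f : Module.End K V} (hf : f ∈ opCentralizer t x y) {i : ι}
    (hi : i ∈ t) (m : V) : f (x i m) = x i (f m) ∧ f (y i m) = y i (f m) := by
  rw [Subalgebra.mem_centralizer_iff] at hf
  exact ⟨(LinearMap.congr_fun (hf _ (Or.inl ⟨i, hi, rfl⟩)) m).symm,
    (LinearMap.congr_fun (hf _ (Or.inr ⟨i, hi, rfl⟩)) m).symm⟩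

open scoped IsMulCommutative in
theorem comm_finite_of_xy_eq_one (h : IsSimpleOneSided t x y) (ht : t.Finite)
    (hxy : ∀ i ∈ t, x i * y i = 1) :
    (∀ f ∈ opCentralizer t x y, ∀ g ∈ opCentralizer t x y, f * g = g * f) ∧
      Module.Finite K (opCentralizer t x y) := by
  have := h.nontrivial
  set s := x '' t ∪ y '' t
  have hcomm : ∀ a ∈ s, ∀ b ∈ s, a * b = b * a := by
    rintro _ (⟨i, hi, rfl⟩ | ⟨i, hi, rfl⟩) _ (⟨j, hj, rfl⟩ | ⟨j, hj, rfl⟩) <;>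
      rcases eq_or_ne i j with rfl | hij
    · rfl
    · exact h.xx i hi j hj hij
    · rw [hxy i hi, h.yx i hi]
    · exact h.xy i hi j hj hij
    · rw [hxy i hi, h.yx i hi]
    · exact (h.xy j hj i hi hij.symm).symm
    · rfl
    · exact h.yy i hi j hj hij
  have := Algebra.isMulCommutative_adjoin K hcomm
  have : Algebra.FiniteType K (Algebra.adjoin K s) :=
    (Subalgebra.fg_iff_finiteType _).mp
      (Subalgebra.fg_def.mpr ⟨s, (ht.image x).union (ht.image y), rfl⟩)
  have : IsSimpleModule (Algebra.adjoin K s) V := by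
    refine (isSimpleModule_iff ..).mpr { eq_bot_or_eq_top := fun U => ?_ }
    refine (h.simple (U.restrictScalars K) fun i hi m hm => ⟨?_, ?_⟩).imp ?_ ?_
    · exact U.smul_mem ⟨x i, Algebra.subset_adjoin (Or.inl ⟨i, hi, rfl⟩)⟩ hm
    · exact U.smul_mem ⟨y i, Algebra.subset_adjoin (Or.inr ⟨i, hi, rfl⟩)⟩ hm
    · simp
    · simp
  obtain ⟨hfin, hc⟩ := finite_and_comm_of_simple_of_comm (K := K) (Algebra.adjoin K s) (V := V)
  refine ⟨fun f hf g hg => ?_, inferInstance⟩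
  have key : ∀ f ∈ Subalgebra.centralizer K s, ∀ a ∈ Algebra.adjoin K s, ∀ m, f (a m) = a (f m) := by
    intro f hf a ha m
    have : a ∈ Subalgebra.centralizer K {f} := by
      refine Algebra.adjoin_le (fun b hb => ?_) ha
      rw [SetLike.mem_coe, Subalgebra.mem_centralizer_iff]
      rintro _ rfl
      exact ((Subalgebra.mem_centralizer_iff K).mp hf b hb).symm
    exact LinearMap.congr_fun ((Subalgebra.mem_centralizer_iff K).mp this f rfl) m
  let lift (f : Module.End K V) (hf : f ∈ Subalgebra.centralizer K s) :
      Module.End (Algebra.adjoin K s) V :=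
    { toFun := f, map_add' := map_add f, map_smul' := fun a m => key f hf a a.2 m }
  ext m
  exact LinearMap.congr_fun (hc (lift f hf) (lift g hg)) m

/-- Passing to the kernel of one of the `y i`. -/
theorem restrict_ker (h : IsSimpleOneSided t x y) {i : ι} (hi : i ∈ t) (hxy : x i * y i ≠ 1)
    (x' y' : ι → Module.End K (LinearMap.ker (y i)))
    (hx' : ∀ j ∈ t \ {i}, ∀ m, (x' j m : V) = x j m)
    (hy' : ∀ j ∈ t \ {i}, ∀ m, (y' j m : V) = y j m) :
    IsSimpleOneSided (t \ {i}) x' y' where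
  yx j hj := by
    ext m
    simpa [hx' j hj, hy' j hj] using LinearMap.congr_fun (h.yx j hj.1) (m : V)
  xx j hj k hk hjk := by
    ext m
    simpa [hx' j hj, hx' k hk] using LinearMap.congr_fun (h.xx j hj.1 k hk.1 hjk) (m : V)
  xy j hj k hk hjk := by
    ext m
    simpa [hx' j hj, hy' k hk] using LinearMap.congr_fun (h.xy j hj.1 k hk.1 hjk) (m : V)
  yy j hj k hk hjk := by
    ext m
    simpa [hy' j hj, hy' k hk] using LinearMap.congr_fun (h.yy j hj.1 k hk.1 hjk) (m : V)
  nontrivial := by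
    obtain ⟨m, hm⟩ : ∃ m, x i (y i m) ≠ m := by
      by_contra! hc
      exact hxy (LinearMap.ext hc)
    have hyx := LinearMap.congr_fun (h.yx i hi) (y i m)
    refine nontrivial_of_ne (⟨m - x i (y i m), ?_⟩ : LinearMap.ker (y i)) 0 ?_
    · simp only [Module.End.mul_apply, Module.End.one_apply] at hyx
      simp [hyx]
    · simpa [Subtype.ext_iff, sub_eq_zero] using hm.symm
  simple W hW := by
    by_cases hW0 : W = ⊥
    · exact Or.inl hW0
    right
    have hyx : ∀ m, y i (x i m) = m := fun m => LinearMap.congr_fun (h.yx i hi) m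
    set W' : Submodule K V := W.map (LinearMap.ker (y i)).subtype with hW'
    have hW'x : ∀ j ∈ t \ {i}, ∀ m ∈ W', x j m ∈ W' ∧ y j m ∈ W' := by
      rintro j hj _ ⟨w, hw, rfl⟩
      exact ⟨⟨x' j w, (hW j hj w hw).1, hx' j hj w⟩, ⟨y' j w, (hW j hj w hw).2, hy' j hj w⟩⟩
    let U : Submodule K V := ⨅ k : ℕ, W'.comap ((1 - x i * y i) * y i ^ k)
    have memU : ∀ m, m ∈ U ↔ ∀ k : ℕ, ((1 - x i * y i) * y i ^ k) m ∈ W' := by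
      intro m; simp [U]
    have hcom : ∀ a : Module.End K V, Commute a (x i) → Commute a (y i) → ∀ k : ℕ, ∀ m,
        ((1 - x i * y i) * y i ^ k) (a m) = a (((1 - x i * y i) * y i ^ k) m) := by
      intro a hax hay k m
      exact LinearMap.congr_fun
        ((((Commute.one_right a).sub_right (hax.mul_right hay)).mul_right
          (hay.pow_right k)).eq.symm) m
    have hWU : W' ≤ U := by
      rintro _ ⟨w, hw, rfl⟩
      rw [memU]
      have hw0 : y i w = 0 := w.2
      rintro (_ | k)
      · simpa [hw0, hW'] using hw
      · simp [pow_succ, hw0]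
    have hU : U = ⊥ ∨ U = ⊤ := by
      refine h.simple U fun j hj m hm => ?_
      rw [memU] at hm
      simp only [memU]
      by_cases hji : j = i
      · subst hji
        refine ⟨?_, fun k => ?_⟩
        · rintro (_ | k)
          · simp [hyx]
          · simpa [pow_succ, hyx] using hm k
        · simpa [pow_succ] using hm (k + 1)
      · have hj' : j ∈ t \ {i} := ⟨hj, hji⟩
        refine ⟨fun k => ?_, fun k => ?_⟩
        · rw [hcom (x j) (h.xx j hj i hi hji) (h.xy j hj i hi hji)]
          exact (hW'x j hj' _ (hm k)).1
        · rw [hcom (y j) (h.xy i hi j hj (Ne.symm hji)).symm (h.yy j hj i hi hji)]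
          exact (hW'x j hj' _ (hm k)).2
    rcases hU with hU | hU
    · exfalso
      apply hW0
      rw [hU, le_bot_iff] at hWU
      exact Submodule.map_injective_of_injective (Submodule.subtype_injective _)
        (hWU.trans (Submodule.map_bot _).symm)
    · rw [eq_top_iff]
      intro m _
      have := (memU m).mp (hU ▸ Submodule.mem_top) 0
      have hm0 : y i m = 0 := m.2
      simpa [hm0, hW'] using this

theorem comm_finite (ht : t.Finite) (h : IsSimpleOneSided t x y) :
    (∀ f ∈ opCentralizer t x y, ∀ g ∈ opCentralizer t x y, f * g = g * f) ∧
      Module.Finite K (opCentralizer t x y) := by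
  induction hn : t.ncard generalizing t V with
  | zero =>
    have ht0 : t = ∅ := (Set.ncard_eq_zero ht).mp hn
    exact h.comm_finite_of_xy_eq_one ht (by simp [ht0])
  | succ n ih =>
    by_cases hxy : ∀ i ∈ t, x i * y i = 1
    · exact h.comm_finite_of_xy_eq_one ht hxy
    push Not at hxy
    obtain ⟨i, hi, hxy⟩ := hxy
    have hstab : ∀ a : Module.End K V, Commute a (y i) →
        ∀ m ∈ LinearMap.ker (y i), a m ∈ LinearMap.ker (y i) := by
      intro a ha m hm
      have := LinearMap.congr_fun ha.eq m
      rw [LinearMap.mem_ker] at hm ⊢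
      simpa [hm] using this.symm
    have hx : ∀ j ∈ t \ {i}, ∀ m ∈ LinearMap.ker (y i), x j m ∈ LinearMap.ker (y i) :=
      fun j hj => hstab _ (h.xy j hj.1 i hi hj.2)
    have hy : ∀ j ∈ t \ {i}, ∀ m ∈ LinearMap.ker (y i), y j m ∈ LinearMap.ker (y i) :=
      fun j hj => hstab _ (h.yy j hj.1 i hi hj.2)
    classical
    let x' : ι → Module.End K (LinearMap.ker (y i)) := fun j =>
      if hj : j ∈ t \ {i} then (x j).restrict (hx j hj) else 0
    let y' : ι → Module.End K (LinearMap.ker (y i)) := fun j =>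
      if hj : j ∈ t \ {i} then (y j).restrict (hy j hj) else 0
    have hx' : ∀ j ∈ t \ {i}, ∀ m, (x' j m : V) = x j m := fun j hj m => by
      simp only [x', dif_pos hj, LinearMap.coe_restrict_apply]
    have hy' : ∀ j ∈ t \ {i}, ∀ m, (y' j m : V) = y j m := fun j hj m => by
      simp only [y', dif_pos hj, LinearMap.coe_restrict_apply]
    have h' := h.restrict_ker hi hxy x' y' hx' hy'
    have hcard : (t \ {i}).ncard = n := by
      rw [Set.ncard_sdiff_singleton_of_mem hi, hn, Nat.add_sub_cancel]
    obtain ⟨hc, hfin⟩ := ih ht.sdiff h' hcard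
    have := isNoetherian_of_isNoetherianRing_of_finite K (opCentralizer (t \ {i}) x' y')
    have hf : ∀ f ∈ opCentralizer t x y, ∀ m ∈ LinearMap.ker (y i), f m ∈ LinearMap.ker (y i) :=
      fun f hf => hstab f (LinearMap.ext fun m => (commute_of_mem_opCentralizer hf hi m).2)
    let r : opCentralizer t x y →ₗ[K] opCentralizer (t \ {i}) x' y' :=
      { toFun f := ⟨(f : Module.End K V).restrict (hf f f.2), by
          rw [Subalgebra.mem_centralizer_iff]
          rintro _ (⟨j, hj, rfl⟩ | ⟨j, hj, rfl⟩) <;> ext m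
          · simp [hx' j hj, (commute_of_mem_opCentralizer f.2 hj.1 (m : V)).1]
          · simp [hy' j hj, (commute_of_mem_opCentralizer f.2 hj.1 (m : V)).2]⟩
        map_add' f g := rfl
        map_smul' c f := rfl }
    have hr : Function.Injective r := by
      refine (injective_iff_map_eq_zero r).mpr fun f hf0 => ?_
      have hker : LinearMap.ker (y i) ≤ LinearMap.ker (f : Module.End K V) := fun m hm =>
        congrArg Subtype.val (LinearMap.congr_fun (congrArg Subtype.val hf0) ⟨m, hm⟩)
      rcases h.simple (LinearMap.ker (f : Module.End K V)) (fun j hj m hm => by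
        rw [LinearMap.mem_ker] at hm
        simp [commute_of_mem_opCentralizer f.2 hj, hm]) with h0 | h0
      · have := h'.nontrivial
        rw [h0, le_bot_iff] at hker
        rw [hker] at this
        exact absurd this (not_nontrivial _)
      · exact Subtype.ext (LinearMap.ker_eq_top.mp h0)
    refine ⟨fun f hf g hg => ?_, Module.Finite.of_injective r hr⟩
    have : (⟨f, hf⟩ * ⟨g, hg⟩ : opCentralizer t x y) = ⟨g, hg⟩ * ⟨f, hf⟩ :=
      hr (Subtype.ext (hc (r ⟨f, hf⟩) (r ⟨f, hf⟩).2 (r ⟨g, hg⟩) (r ⟨g, hg⟩).2))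
    exact congrArg Subtype.val this

end IsSimpleOneSided

theorem Xop_monomial (K : Type u) [Field K] (n : ℕ) (i : Fin n) (α : Fin n →₀ ℕ) :
    Xop K n i (monomial α 1) = monomial (Finsupp.single i 1 + α) 1 := by
  simp [Xop, X, monomial_mul]

theorem Yop_monomial (K : Type u) [Field K] (n : ℕ) (i : Fin n) (α : Fin n →₀ ℕ) :
    Yop K n i (monomial α 1) = if α i = 0 then 0 else monomial (α - Finsupp.single i 1) 1 := by
  have := (basisMonomials (Fin n) K).constr_basis K (fun α : Fin n →₀ ℕ =>
    if α i = 0 then 0 else monomial (α - Finsupp.single i 1) (1 : K)) α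
  rwa [coe_basisMonomials] at this

theorem ext_monomial {K : Type u} [Field K] {n : ℕ} {f g : Module.End K (PolyAlg K n)}
    (h : ∀ α, f (monomial α 1) = g (monomial α 1)) : f = g :=
  (basisMonomials (Fin n) K).ext fun α => by simpa using h α

theorem yS_mul_xS (K : Type u) [Field K] (n : ℕ) (i : Fin n) : yS K n i * xS K n i = 1 := by
  refine Subtype.ext (ext_monomial fun α => ?_)
  simp [yS, xS, Xop_monomial, Yop_monomial]

theorem commute_xS (K : Type u) [Field K] (n : ℕ) (i j : Fin n) :
    Commute (xS K n i) (xS K n j) := by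
  refine Subtype.ext (ext_monomial fun α => ?_)
  simp [xS, Xop_monomial, add_left_comm]

theorem commute_xS_yS (K : Type u) [Field K] (n : ℕ) {i j : Fin n} (hij : i ≠ j) :
    Commute (xS K n i) (yS K n j) := by
  refine Subtype.ext (ext_monomial fun α => ?_)
  by_cases hj : α j = 0
  · simp [xS, yS, Xop_monomial, Yop_monomial, hj, hij]
  · have hle : Finsupp.single j 1 ≤ α :=
      Finsupp.single_le_iff.mpr (Nat.one_le_iff_ne_zero.mpr hj)
    simp [xS, yS, Xop_monomial, Yop_monomial, hj, hij, add_tsub_assoc_of_le hle]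

theorem commute_yS (K : Type u) [Field K] (n : ℕ) {i j : Fin n} (hij : i ≠ j) :
    Commute (yS K n i) (yS K n j) := by
  refine Subtype.ext (ext_monomial fun α => ?_)
  by_cases hi : α i = 0 <;> by_cases hj : α j = 0 <;>
    simp [yS, Yop_monomial, hi, hj, hij, hij.symm, tsub_right_comm]

/-- An additive subgroup stable under scalars and the generators of `S_n` is stable under `S_n`. -/
theorem smul_mem_of_generators {K : Type u} [Field K] {n : ℕ} {M : Type v} [AddCommGroup M]
    [Module (SnAlg K n) M] (U : AddSubgroup M)
    (hK : ∀ (c : K), ∀ m ∈ U, algebraMap K (SnAlg K n) c • m ∈ U)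
    (hx : ∀ i, ∀ m ∈ U, xS K n i • m ∈ U) (hy : ∀ i, ∀ m ∈ U, yS K n i • m ∈ U)
    (s : SnAlg K n) : ∀ m ∈ U, s • m ∈ U := by
  obtain ⟨s, hs⟩ := s
  induction hs using Algebra.adjoin_induction with
  | mem a ha =>
    rcases ha with ⟨i, rfl⟩ | ⟨i, rfl⟩
    · exact hx i
    · exact hy i
  | algebraMap c => exact hK c
  | add a b ha hb iha ihb =>
    intro m hm
    have := U.add_mem (iha m hm) (ihb m hm)
    rwa [← add_smul] at this
  | mul a b ha hb iha ihb =>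
    intro m hm
    have := iha _ (ihb m hm)
    rwa [smul_smul] at this

end OneSidedInverses

/-- for every simple left `S_n`-module `M`, the endomorphism ring
`End_{S_n}(M)` is commutative and is a finite-dimensional field extension of `K` (where `K`
acts on `End_{S_n}(M)` via `centralEnd`). -/
theorem statement17 (K : Type u) [Field K] (n : ℕ) (hn : 0 < n)
    (M : ModuleCat.{u} (SnAlg K n)) (hM : IsSimpleModule (SnAlg K n) M) :
    (∀ f g : Module.End (SnAlg K n) M, f * g = g * f) ∧
    Nontrivial (Module.End (SnAlg K n) M) ∧
    (∀ f : Module.End (SnAlg K n) M, f ≠ 0 → ∃ g, f * g = 1) ∧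
    (letI : Module K (Module.End (SnAlg K n) M) :=
      Module.compHom _ (centralEnd K (SnAlg K n) M)
     FiniteDimensional K (Module.End (SnAlg K n) M)) := by
  have := IsSimpleModule.nontrivial (SnAlg K n) M
  let : Module K M := Module.compHom M (algebraMap K (SnAlg K n))
  have : IsScalarTower K (SnAlg K n) M := .of_algebraMap_smul fun _ _ => rfl
  let x (i : Fin n) : Module.End K M := Algebra.lsmul K K M (xS K n i)
  let y (i : Fin n) : Module.End K M := Algebra.lsmul K K M (yS K n i)
  have h : IsSimpleOneSided Set.univ x y :=
    { yx i _ := by rw [← map_mul, yS_mul_xS, map_one]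
      xx i _ j _ _ := (commute_xS K n i j).map _
      xy i _ j _ hij := (commute_xS_yS K n hij).map _
      yy i _ j _ hij := (commute_yS K n hij).map _
      nontrivial := IsSimpleModule.nontrivial (SnAlg K n) M
      simple U hU := by
        let U' : Submodule (SnAlg K n) M :=
          { U with
            smul_mem' := fun s m hm => smul_mem_of_generators U.toAddSubgroup
              (fun c m hm => U.smul_mem c hm) (fun i m hm => (hU i trivial m hm).1)
              (fun i m hm => (hU i trivial m hm).2) s m hm }
        refine (eq_bot_or_eq_top U').imp (fun h => ?_) fun h => ?_ <;> ext m
        · exact SetLike.ext_iff.mp h m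
        · exact SetLike.ext_iff.mp h m }
  obtain ⟨hc, hfin⟩ := h.comm_finite Set.finite_univ
  have hmem : ∀ f : Module.End (SnAlg K n) M, f.restrictScalars K ∈ opCentralizer Set.univ x y := by
    intro f
    rw [Subalgebra.mem_centralizer_iff]
    rintro _ (⟨i, -, rfl⟩ | ⟨i, -, rfl⟩) <;> ext m
    · exact (f.map_smul (xS K n i) m).symm
    · exact (f.map_smul (yS K n i) m).symm
  refine ⟨fun f g => ?_, inferInstance, fun f hf => ?_, ?_⟩
  · ext m
    exact LinearMap.congr_fun (hc _ (hmem f) _ (hmem g)) m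
  · let e := LinearEquiv.ofBijective f (LinearMap.bijective_of_ne_zero hf)
    exact ⟨e.symm, LinearMap.ext fun m => e.apply_symm_apply m⟩
  · let : Module K (Module.End (SnAlg K n) M) := Module.compHom _ (centralEnd K (SnAlg K n) M)
    let r : Module.End (SnAlg K n) M →ₗ[K] opCentralizer Set.univ x y :=
      { toFun f := ⟨f.restrictScalars K, hmem f⟩
        map_add' f g := rfl
        map_smul' c f := rfl }
    have := isNoetherian_of_isNoetherianRing_of_finite K (opCentralizer Set.univ x y)
    refine Module.Finite.of_injective r fun f g hfg => ?_
    ext m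
    exact LinearMap.congr_fun (congrArg Subtype.val hfg) m
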